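/- The polynomials B_n(s,t,q) (with B_0 = 1) satisfy the following identities in the rational-function field ℚ(q,s,t). If n = 2k is a positive even integer: B_n(s,t,q)/B_n(1,q) = (1−t)^k(1−s)^{k+1}/B_n(1,q) + Σ_{r=0}^{k−1} t(1−t)^r(1−s)^{r+1}·B_{n−2r−1}(s,t,q)/(B_{n−2r−1}(1,q)·[2r+1]_q!) + Σ_{r=0}^{k} s(1−t)^r(1−s)^r·B_{n−2r}(s,t,q)/(B_{n−2r}(1,q)·[2r]_q!). If n = 2k+1 is a positive odd integer: B_n(s,t,q)/B_n(1,q) = (1−t)^{k+1}(1−s)^{k+1}/B_n(1,q) + Σ_{r=0}^{k} s(1−t)^{r+1}(1−s)^r·B_{n−2r−1}(s,t,q)/(B_{n−2r−1}(1,q)·[2r+1]_q!) + Σ_{r=0}^{k} t(1−t)^r(1−s)^r·B_{n−2r}(s,t,q)/(B_{n−2r}(1,q)·[2r]_q!). -/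

import Mathlib

open Finset

/-- The hyperoctahedral group `𝔅_n`, encoded as (permutation of positions, signs):
the signed permutation sends `i+1` to `±(σ i + 1)`. -/
abbrev BG (n : ℕ) := Equiv.Perm (Fin n) × (Fin n → Bool)

/-- The value `π_i` (for `1 ≤ i ≤ n`) of the signed permutation, with `π_0 = 0`. -/
def bval {n : ℕ} (w : BG n) (i : ℕ) : ℤ :=
  if h : 1 ≤ i ∧ i ≤ n then
    (if w.2 ⟨i - 1, by omega⟩ then -1 else 1) * (((w.1 ⟨i - 1, by omega⟩ : Fin n) : ℕ) + 1 : ℤ)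
  else 0

/-- `edes_B`: even `i ∈ {0,…,n−1}` with `π_i > π_{i+1}`. -/
def edesB {n : ℕ} (w : BG n) : ℕ :=
  ((range n).filter fun i => Even i ∧ bval w (i + 1) < bval w i).card

/-- `odes_B`: odd `i ∈ {0,…,n−1}` with `π_i > π_{i+1}`. -/
def odesB {n : ℕ} (w : BG n) : ℕ :=
  ((range n).filter fun i => Odd i ∧ bval w (i + 1) < bval w i).card

/-- `easc_B`: even `i ∈ {0,…,n−1}` with `π_i < π_{i+1}`. -/
def eascB {n : ℕ} (w : BG n) : ℕ :=
  ((range n).filter fun i => Even i ∧ bval w i < bval w (i + 1)).card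

/-- `oasc_B`: odd `i ∈ {0,…,n−1}` with `π_i < π_{i+1}`. -/
def oascB {n : ℕ} (w : BG n) : ℕ :=
  ((range n).filter fun i => Odd i ∧ bval w i < bval w (i + 1)).card

/-- type B inversion number -/
def invB {n : ℕ} (w : BG n) : ℕ :=
  ((Icc 1 n ×ˢ Icc 1 n).filter fun p => p.1 < p.2 ∧ bval w p.2 < bval w p.1).card
  + ((Icc 1 n ×ˢ Icc 1 n).filter fun p => p.1 < p.2 ∧ bval w p.2 < -bval w p.1).card
  + ((Icc 1 n).filter fun i => bval w i < 0).card

/-- `B_n(s,t,q)` -/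
noncomputable def Bpoly {A : Type*} [CommRing A] (n : ℕ) (s t q : A) : A :=
  ∑ w : BG n, s ^ edesB w * t ^ odesB w * q ^ invB w

/-- `B_n(1,q)` -/
noncomputable def BOne {A : Type*} [CommRing A] (n : ℕ) (q : A) : A :=
  ∑ w : BG n, q ^ invB w

/-- `[k]_q` -/
def qInt {A : Type*} [CommRing A] (k : ℕ) (q : A) : A := ∑ i ∈ range k, q ^ i

/-- `[k]_q!` -/
def qFact {A : Type*} [CommRing A] (k : ℕ) (q : A) : A := ∏ i ∈ range k, qInt (i + 1) q

noncomputable section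

/-- the field `ℚ(q,s,t)` -/
abbrev K : Type := FractionRing (MvPolynomial (Fin 3) ℚ)

def qK : K := algebraMap (MvPolynomial (Fin 3) ℚ) K (MvPolynomial.X 0)
def sK : K := algebraMap (MvPolynomial (Fin 3) ℚ) K (MvPolynomial.X 1)
def tK : K := algebraMap (MvPolynomial (Fin 3) ℚ) K (MvPolynomial.X 2)

/-- the ring `R = ℚ(q,s,t)[M]/(M² − (1−s)(1−t))` -/
abbrev R : Type := AdjoinRoot ((Polynomial.X : Polynomial K) ^ 2
  - Polynomial.C ((1 - sK) * (1 - tK)))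

/-- the square root `M` of `(1−s)(1−t)` -/
def M : R := AdjoinRoot.root _

def ofK : K →+* R := algebraMap K R

/-- The type B inversion number of the word `a 1, …, a n`. -/
def wordInv (a : ℕ → ℤ) (n : ℕ) : ℕ :=
  ((Icc 1 n ×ˢ Icc 1 n).filter fun p => p.1 < p.2 ∧ a p.2 < a p.1).card
  + ((Icc 1 n ×ˢ Icc 1 n).filter fun p => p.1 < p.2 ∧ a p.2 < -a p.1).card
  + ((Icc 1 n).filter fun i => a i < 0).card

lemma card_filter_lt_eq_sum_col (r : ℕ → ℕ → Prop) [∀ i j, Decidable (r i j)] (n : ℕ) :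
    ((Icc 1 n ×ˢ Icc 1 n).filter fun p => p.1 < p.2 ∧ r p.1 p.2).card
      = ∑ j ∈ Icc 1 n, ((Ico 1 j).filter fun i => r i j).card := by
  rw [card_filter, sum_product_right]
  refine sum_congr rfl fun j hj => ?_
  rw [← card_filter]
  congr 1
  ext i
  simp only [mem_filter, mem_Icc, mem_Ico] at hj ⊢
  grind

lemma card_filter_lt_eq_sum_row (r : ℕ → ℕ → Prop) [∀ i j, Decidable (r i j)] (n : ℕ) :
    ((Icc 1 n ×ˢ Icc 1 n).filter fun p => p.1 < p.2 ∧ r p.1 p.2).card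
      = ∑ i ∈ Icc 1 n, ((Ioc i n).filter fun j => r i j).card := by
  rw [card_filter, sum_product]
  refine sum_congr rfl fun i hi => ?_
  rw [← card_filter]
  congr 1
  ext j
  simp only [mem_filter, mem_Icc, mem_Ioc] at hi ⊢
  grind

lemma wordInv_succ (a : ℕ → ℤ) (n : ℕ) :
    wordInv a (n + 1) = wordInv a n + (((Icc 1 n).filter fun i => a (n + 1) < a i).card
      + ((Icc 1 n).filter fun i => a (n + 1) < -a i).card
      + if a (n + 1) < 0 then 1 else 0) := by
  unfold wordInv
  rw [card_filter_lt_eq_sum_col (fun i j => a j < a i),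
    card_filter_lt_eq_sum_col (fun i j => a j < -a i),
    card_filter_lt_eq_sum_col (fun i j => a j < a i),
    card_filter_lt_eq_sum_col (fun i j => a j < -a i),
    sum_Icc_succ_top (by omega), sum_Icc_succ_top (by omega),
    card_filter (fun i => a i < 0) (Icc 1 (n + 1)), sum_Icc_succ_top (by omega), ← card_filter]
  have h : Ico 1 (n + 1) = Icc 1 n := by ext; simp
  rw [h]
  omega

lemma wordInv_congr {a b : ℕ → ℤ} {h : ℤ → ℤ} (hm : StrictMono h) (ho : ∀ x, h (-x) = -h x)
    {n : ℕ} (hab : ∀ i ≤ n, b i = h (a i)) : wordInv b n = wordInv a n := by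
  have h0 : h 0 = 0 := by have := ho 0; simp only [neg_zero] at this; omega
  unfold wordInv
  congr 1
  · congr 1
    · congr 1
      refine filter_congr fun p hp => ?_
      simp only [mem_product, mem_Icc] at hp
      rw [hab _ hp.1.2, hab _ hp.2.2, hm.lt_iff_lt]
    · congr 1
      refine filter_congr fun p hp => ?_
      simp only [mem_product, mem_Icc] at hp
      rw [hab _ hp.1.2, hab _ hp.2.2, ← ho, hm.lt_iff_lt]
  · congr 1
    refine filter_congr fun i hi => ?_
    rw [mem_Icc] at hi
    rw [hab _ hi.2, ← hm.lt_iff_lt (a := a i), h0]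

lemma two_mul_card_filter_lt (r : ℕ → ℕ → Prop) [∀ i j, Decidable (r i j)]
    (hr : ∀ i j, r i j → r j i) (n : ℕ) :
    2 * ((Icc 1 n ×ˢ Icc 1 n).filter fun p => p.1 < p.2 ∧ r p.1 p.2).card
      + ((Icc 1 n).filter fun i => r i i).card
      = ∑ i ∈ Icc 1 n, ∑ j ∈ Icc 1 n, if r i j then 1 else 0 := by
  have hswap : ((Icc 1 n ×ˢ Icc 1 n).filter fun p => p.1 < p.2 ∧ r p.1 p.2).card
      = ∑ i ∈ Icc 1 n, ∑ j ∈ Icc 1 n, if j < i ∧ r i j then 1 else 0 := by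
    rw [card_filter, sum_product_right]
    refine sum_congr rfl fun i _ => sum_congr rfl fun j _ => ?_
    have := hr i j
    have := hr j i
    grind
  have hdiag : ((Icc 1 n).filter fun i => r i i).card
      = ∑ i ∈ Icc 1 n, ∑ j ∈ Icc 1 n, if i = j ∧ r i j then 1 else 0 := by
    rw [card_filter]
    refine sum_congr rfl fun i hi => ?_
    rw [sum_eq_single i (by grind) (by grind)]
    simp
  rw [two_mul]
  nth_rewrite 2 [hswap]
  rw [hdiag, card_filter, sum_product]
  simp only [← sum_add_distrib]
  refine sum_congr rfl fun i _ => sum_congr rfl fun j _ => ?_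
  grind

lemma swap_mem_Icc {p n : ℕ} (hp : 1 ≤ p) (hpn : p ≤ n) (i : ℕ) :
    i ∈ Icc 1 n ↔ Equiv.swap p n i ∈ Icc 1 n := by
  simp only [mem_Icc, Equiv.swap_apply_def]
  split_ifs <;> omega

lemma card_filter_swap {p n : ℕ} (hp : 1 ≤ p) (hpn : p ≤ n) (f : ℕ → Prop) [DecidablePred f] :
    ((Icc 1 n).filter fun i => f (Equiv.swap p n i)).card = ((Icc 1 n).filter f).card := by
  rw [card_filter, card_filter]
  exact sum_equiv (Equiv.swap p n) (swap_mem_Icc hp hpn) fun _ _ => rfl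

lemma card_negative_pairs_swap {p n : ℕ} (hp : 1 ≤ p) (hpn : p ≤ n) (a : ℕ → ℤ) :
    ((Icc 1 n ×ˢ Icc 1 n).filter fun x => x.1 < x.2 ∧
      a (Equiv.swap p n x.2) < -a (Equiv.swap p n x.1)).card
      = ((Icc 1 n ×ˢ Icc 1 n).filter fun x => x.1 < x.2 ∧ a x.2 < -a x.1).card := by
  have h₁ := two_mul_card_filter_lt (fun i j => a (Equiv.swap p n j) < -a (Equiv.swap p n i))
    (fun i j h => by omega) n
  have h₂ := two_mul_card_filter_lt (fun i j => a j < -a i) (fun i j h => by omega) n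
  have h₃ := card_filter_swap hp hpn (fun i => a i < -a i)
  have h₄ : (∑ i ∈ Icc 1 n, ∑ j ∈ Icc 1 n,
      if a (Equiv.swap p n j) < -a (Equiv.swap p n i) then 1 else 0)
      = ∑ i ∈ Icc 1 n, ∑ j ∈ Icc 1 n, if a j < -a i then 1 else 0 :=
    sum_equiv (Equiv.swap p n) (swap_mem_Icc hp hpn) fun i _ =>
      sum_equiv (Equiv.swap p n) (swap_mem_Icc hp hpn) fun _ _ => rfl
  omega

lemma card_inversions_swap {p n : ℕ} (hp : 1 ≤ p) (hpn : p < n) {a : ℕ → ℤ} (hlt : a p < a n)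
    (hgt : ∀ i, p < i → i < n → a n < a i) :
    ((Icc 1 n ×ˢ Icc 1 n).filter fun x => x.1 < x.2 ∧
      a (Equiv.swap p n x.2) < a (Equiv.swap p n x.1)).card
      = ((Icc 1 n ×ˢ Icc 1 n).filter fun x => x.1 < x.2 ∧ a x.2 < a x.1).card + 1 := by
  rw [card_filter_lt_eq_sum_row (fun i j => a (Equiv.swap p n j) < a (Equiv.swap p n i)),
    card_filter_lt_eq_sum_row (fun i j => a j < a i)]
  have h1 : (∑ i ∈ Icc 1 n, if i = p then 1 else 0) = 1 := by
    rw [sum_ite_eq', if_pos (mem_Icc.2 ⟨hp, hpn.le⟩)]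
  refine Eq.trans ?_ (congrArg (HAdd.hAdd _) h1)
  rw [← sum_add_distrib]
  refine sum_congr rfl fun i hi => ?_
  rw [mem_Icc] at hi
  rcases lt_trichotomy i p with hip | rfl | hip
  · rw [if_neg hip.ne, add_zero, card_filter, card_filter]
    refine sum_equiv (Equiv.swap p n) (fun j => ?_) fun j hj => ?_
    · simp only [mem_Ioc, Equiv.swap_apply_def]
      split_ifs <;> omega
    · rw [Equiv.swap_apply_of_ne_of_ne (x := i) (by omega) (by omega)]
  · rw [if_pos rfl, filter_false_of_mem (s := Ioc i n) (p := fun j => a j < a i), card_empty,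
      zero_add, card_eq_one]
    · refine ⟨n, ?_⟩
      ext j
      simp only [mem_filter, mem_Ioc, mem_singleton, Equiv.swap_apply_left]
      constructor
      · rintro ⟨hj, hj'⟩
        by_contra hne
        rw [Equiv.swap_apply_of_ne_of_ne (by omega) hne] at hj'
        have := hgt j (by omega) (by omega)
        omega
      · rintro rfl
        simpa [hpn] using hlt
    · intro j hj
      rw [mem_Ioc] at hj
      rcases hj.2.lt_or_eq with h | rfl
      · have := hgt j hj.1 h
        omega
      · omega
  · rw [if_neg hip.ne', add_zero]
    congr 1
    refine filter_congr fun j hj => ?_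
    rw [mem_Ioc] at hj
    rw [Equiv.swap_apply_of_ne_of_ne (x := i) (by omega) (by omega)]
    rcases hj.2.lt_or_eq with h | rfl
    · rw [Equiv.swap_apply_of_ne_of_ne (x := j) (by omega) (by omega)]
    · rw [Equiv.swap_apply_right]
      have := hgt i hip (by omega)
      constructor <;> intro <;> omega

lemma wordInv_swap {p n : ℕ} (hp : 1 ≤ p) (hpn : p < n) {a : ℕ → ℤ} (hlt : a p < a n)
    (hgt : ∀ i, p < i → i < n → a n < a i) :
    wordInv (fun i => a (Equiv.swap p n i)) n = wordInv a n + 1 := by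
  unfold wordInv
  rw [card_inversions_swap hp hpn hlt hgt, card_negative_pairs_swap hp hpn.le,
    card_filter_swap hp hpn.le fun i => a i < 0]
  ring

lemma bval_zero {n : ℕ} (w : BG n) : bval w 0 = 0 := by simp [bval]

lemma bval_succ {n : ℕ} (w : BG n) (i : Fin n) :
    bval w (i + 1) = (if w.2 i then -1 else 1) * (((w.1 i : Fin n) : ℕ) + 1 : ℤ) := by
  have h : 1 ≤ (i : ℕ) + 1 ∧ (i : ℕ) + 1 ≤ n := by omega
  simp [bval, h]

lemma exists_fin_of_mem {n i : ℕ} (h₁ : 1 ≤ i) (h₂ : i ≤ n) : ∃ j : Fin n, i = j + 1 :=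
  ⟨⟨i - 1, by omega⟩, by simp; omega⟩

lemma bval_ne_zero {n : ℕ} (w : BG n) {i : ℕ} (h₁ : 1 ≤ i) (h₂ : i ≤ n) : bval w i ≠ 0 := by
  obtain ⟨i, rfl⟩ := exists_fin_of_mem h₁ h₂
  rw [bval_succ]
  split_ifs <;> omega

lemma bval_injOn {n : ℕ} (w : BG n) {i j : ℕ} (hi : i ≤ n) (hj : j ≤ n)
    (h : bval w i = bval w j) : i = j := by
  rcases Nat.eq_zero_or_pos i with rfl | hi'
  · by_contra hne
    exact bval_ne_zero w (by omega) hj (h.symm.trans (bval_zero w))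
  rcases Nat.eq_zero_or_pos j with rfl | hj'
  · exact absurd (h.trans (bval_zero w)) (bval_ne_zero w hi' hi)
  obtain ⟨i, rfl⟩ := exists_fin_of_mem hi' hi
  obtain ⟨j, rfl⟩ := exists_fin_of_mem hj' hj
  rw [bval_succ, bval_succ] at h
  have : (w.1 i : ℕ) = w.1 j := by split_ifs at h <;> omega
  rw [w.1.injective (Fin.ext this)]

/-- Append a last letter `±(p + 1)` to a signed permutation, relabelling the other letters
monotonically. -/
def appendLetter {n : ℕ} (x : BG n × Fin (n + 1) × Bool) : BG (n + 1) :=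
  (((finSuccEquiv' (Fin.last n)).trans (Equiv.optionCongr x.1.1)).trans (finSuccEquiv' x.2.1).symm,
    Fin.snoc (α := fun _ => Bool) x.1.2 x.2.2)

lemma appendLetter_perm_last {n : ℕ} (x : BG n × Fin (n + 1) × Bool) :
    (appendLetter x).1 (Fin.last n) = x.2.1 := by
  simp [appendLetter]

lemma appendLetter_perm_castSucc {n : ℕ} (x : BG n × Fin (n + 1) × Bool) (i : Fin n) :
    (appendLetter x).1 i.castSucc = x.2.1.succAbove (x.1.1 i) := by
  rw [← Fin.succAbove_last]
  simp [appendLetter, -Fin.succAbove_last]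

lemma appendLetter_sign_last {n : ℕ} (x : BG n × Fin (n + 1) × Bool) :
    (appendLetter x).2 (Fin.last n) = x.2.2 := by
  simp [appendLetter]

lemma appendLetter_sign_castSucc {n : ℕ} (x : BG n × Fin (n + 1) × Bool) (i : Fin n) :
    (appendLetter x).2 i.castSucc = x.1.2 i := by
  simp [appendLetter]

lemma appendLetter_bijective (n : ℕ) : Function.Bijective (appendLetter (n := n)) := by
  rw [Fintype.bijective_iff_injective_and_card]
  constructor
  · rintro ⟨w, p, b⟩ ⟨w', p', b'⟩ h
    have hp : p = p' := by
      simpa only [appendLetter_perm_last] using congrArg (fun u => u.1 (Fin.last n)) h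
    have hb : b = b' := by
      simpa only [appendLetter_sign_last] using congrArg (fun u => u.2 (Fin.last n)) h
    subst hp hb
    have h₁ : w.1 = w'.1 := by
      ext i
      have := congrArg (fun u => u.1 i.castSucc) h
      simp only [appendLetter_perm_castSucc] at this
      rw [Fin.succAbove_right_injective this]
    have h₂ : w.2 = w'.2 := by
      funext i
      simpa only [appendLetter_sign_castSucc] using congrArg (fun u => u.2 i.castSucc) h
    rw [Prod.ext h₁ h₂]
  · simp only [Fintype.card_prod, Fintype.card_perm, Fintype.card_fin, Fintype.card_fun,
      Fintype.card_bool, Nat.factorial_succ]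
    ring

/-- The odd monotone relabelling of `ℤ` whose image omits `±(p + 1)`. -/
def relabel (p : ℕ) (x : ℤ) : ℤ := if (p : ℤ) < x then x + 1 else if x < -p then x - 1 else x

lemma relabel_strictMono (p : ℕ) : StrictMono (relabel p) := by
  intro x y h
  unfold relabel
  split_ifs <;> omega

lemma relabel_neg (p : ℕ) (x : ℤ) : relabel p (-x) = -relabel p x := by
  unfold relabel
  split_ifs <;> omega

lemma bval_appendLetter {n : ℕ} (x : BG n × Fin (n + 1) × Bool) {i : ℕ} (hi : i ≤ n) :
    bval (appendLetter x) i = relabel x.2.1 (bval x.1 i) := by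
  rcases Nat.eq_zero_or_pos i with rfl | h
  · rw [bval_zero, bval_zero, relabel, if_neg (by omega), if_neg (by omega)]
  · obtain ⟨i, rfl⟩ := exists_fin_of_mem h hi
    have := bval_succ (appendLetter x) i.castSucc
    rw [Fin.val_castSucc] at this
    rw [this, bval_succ, appendLetter_perm_castSucc, appendLetter_sign_castSucc]
    simp only [relabel, Fin.succAbove, Fin.lt_def, Fin.val_castSucc]
    split_ifs <;> simp <;> omega

lemma bval_appendLetter_last {n : ℕ} (x : BG n × Fin (n + 1) × Bool) :
    bval (appendLetter x) (n + 1) = (if x.2.2 then -1 else 1) * ((x.2.1 : ℕ) + 1 : ℤ) := by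
  have := bval_succ (appendLetter x) (Fin.last n)
  rwa [Fin.val_last, appendLetter_perm_last, appendLetter_sign_last] at this

lemma sum_Icc_eq_sum_fin (n : ℕ) (f : ℕ → ℕ) : ∑ i ∈ Icc 1 n, f i = ∑ i : Fin n, f (i + 1) := by
  rw [Fin.sum_univ_eq_sum_range (fun i => f (i + 1)) n, range_eq_Ico, sum_Ico_add' f 0 n 1]
  rfl

lemma sum_fin_le_ite (n p : ℕ) (hp : p ≤ n) (c d : ℕ) :
    ∑ i : Fin n, (if p ≤ (i : ℕ) then c else d) = (n - p) * c + p * d := by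
  rw [Fin.sum_univ_eq_sum_range (fun i => if p ≤ i then c else d) n]
  obtain ⟨k, rfl⟩ := Nat.exists_eq_add_of_le hp
  rw [sum_range_add]
  have h₁ : ∑ i ∈ range p, (if p ≤ i then c else d) = p * d := by
    rw [sum_congr rfl (g := fun _ => d) fun i hi => if_neg (not_le.2 (mem_range.1 hi))]
    simp
  simp [h₁, add_comm]

lemma wordInv_appendLetter {n : ℕ} (x : BG n × Fin (n + 1) × Bool) :
    wordInv (bval (appendLetter x)) (n + 1) = wordInv (bval x.1) n
      + if x.2.2 then n + 1 + x.2.1 else n - x.2.1 := by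
  rw [wordInv_succ, wordInv_congr (relabel_strictMono x.2.1) (relabel_neg x.2.1)
    fun i hi => bval_appendLetter x hi]
  congr 1
  have key : ((Icc 1 n).filter fun i => bval (appendLetter x) (n + 1)
        < bval (appendLetter x) i).card
      + ((Icc 1 n).filter fun i => bval (appendLetter x) (n + 1)
        < -bval (appendLetter x) i).card
      = ∑ i : Fin n, if (x.2.1 : ℕ) ≤ i then 1 else if x.2.2 then 2 else 0 := by
    rw [card_filter, card_filter, ← sum_add_distrib, sum_Icc_eq_sum_fin,
      ← Equiv.sum_comp x.1.1 fun i : Fin n => if (x.2.1 : ℕ) ≤ i then 1 else if x.2.2 then 2 else 0]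
    refine sum_congr rfl fun i _ => ?_
    rw [bval_appendLetter_last, bval_appendLetter _ (by omega), bval_succ]
    simp only [relabel]
    split_ifs <;> first | rfl | (exfalso; omega)
  rw [key, sum_fin_le_ite n x.2.1 (by omega), bval_appendLetter_last]
  split_ifs <;> omega

/-- The signed permutation obtained by exchanging the letters in positions `p` and `n + 1`. -/
def swapLast {n : ℕ} (p : Fin (n + 1)) : BG (n + 1) ≃ BG (n + 1) where
  toFun w := ((Equiv.swap p (Fin.last n)).trans w.1, w.2 ∘ Equiv.swap p (Fin.last n))
  invFun w := ((Equiv.swap p (Fin.last n)).trans w.1, w.2 ∘ Equiv.swap p (Fin.last n))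
  left_inv w := by ext <;> simp
  right_inv w := by ext <;> simp

lemma bval_swapLast {n : ℕ} (p : Fin (n + 1)) (w : BG (n + 1)) (i : ℕ) :
    bval (swapLast p w) i = bval w (Equiv.swap ((p : ℕ) + 1) (n + 1) i) := by
  by_cases h : 1 ≤ i ∧ i ≤ n + 1
  · obtain ⟨i, rfl⟩ := exists_fin_of_mem h.1 h.2
    have : Equiv.swap ((p : ℕ) + 1) (n + 1) (i + 1)
        = (Equiv.swap p (Fin.last n) i : Fin (n + 1)) + 1 := by
      simp only [Equiv.swap_apply_def, Fin.ext_iff, Fin.val_last]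
      split_ifs <;> simp_all
    rw [this, bval_succ, bval_succ]
    rfl
  · rw [Equiv.swap_apply_of_ne_of_ne (by omega) (by omega)]
    simp [bval, h]

/-- The word `a` increases strictly on the positions `l, …, n`. -/
def AscOn (a : ℕ → ℤ) (l n : ℕ) : Prop := ∀ i j, l ≤ i → i < j → j ≤ n → a i < a j

/-- The letters of `a` in positions `m + 1, …, n` increase, and the letter in position `n + 1`
belongs right after position `p`. -/
def IsCut (a : ℕ → ℤ) (m n p : ℕ) : Prop :=
  AscOn a (m + 1) n ∧ (∀ i, m < i → i ≤ p → a i < a (n + 1)) ∧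
    ∀ i, p < i → i ≤ n → a (n + 1) < a i

lemma isCut_swap (a : ℕ → ℤ) {m n p : ℕ} (hmp : m ≤ p) (hpn : p < n) :
    IsCut (fun i => a (Equiv.swap (p + 1) (n + 1) i)) m n p ↔ IsCut a m n (p + 1) := by
  have h₁ : Equiv.swap (p + 1) (n + 1) (p + 1) = n + 1 := Equiv.swap_apply_left _ _
  have h₂ : Equiv.swap (p + 1) (n + 1) (n + 1) = p + 1 := Equiv.swap_apply_right _ _
  have h₃ : ∀ i, i ≠ p + 1 → i ≤ n → Equiv.swap (p + 1) (n + 1) i = i := fun i h h' =>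
    Equiv.swap_apply_of_ne_of_ne h (by omega)
  generalize Equiv.swap (p + 1) (n + 1) = e at h₁ h₂ h₃
  unfold IsCut AscOn
  simp only [h₂]
  constructor
  · rintro ⟨ha, hb, hc⟩
    refine ⟨fun i j hi hij hj => ?_, fun i hi hip => ?_, fun i hi hin => ?_⟩
    · have := ha i j hi hij hj
      have := hb i hi
      have := hc j
      grind
    · have := ha i (p + 1) hi
      have := hc (p + 1)
      grind
    · have := ha (p + 1) i (by omega) hi hin
      grind
  · rintro ⟨ha, hb, hc⟩
    refine ⟨fun i j hi hij hj => ?_, fun i hi hip => ?_, fun i hi hin => ?_⟩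
    · have := ha i j hi hij hj
      have := hb i hi
      have := hc j
      grind
    · have := ha i (p + 1) hi
      grind
    · have := ha (p + 1) i
      have := hb (p + 1)
      grind

lemma isCut_self_iff (a : ℕ → ℤ) (m n : ℕ) : IsCut a m n n ↔ AscOn a (m + 1) (n + 1) := by
  constructor
  · rintro ⟨ha, hb, -⟩ i j hi hij hj
    rcases hj.lt_or_eq with h | rfl
    · exact ha i j hi hij (by omega)
    · exact hb i hi (by omega)
  · intro h
    exact ⟨fun i j hi hij hj => h i j hi hij (by omega), fun i hi hin => h i _ hi (by omega) le_rfl,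
      fun i hi hin => by omega⟩

lemma IsCut.eq {a : ℕ → ℤ} {m n p p' : ℕ} (h : IsCut a m n p) (h' : IsCut a m n p')
    (hp : m ≤ p) (hp' : m ≤ p') (hpn : p ≤ n) (hpn' : p' ≤ n) : p = p' := by
  rcases lt_trichotomy p p' with hlt | heq | hlt
  · exact absurd (h.2.2 p' hlt hpn') (h'.2.1 p' (by omega) le_rfl).not_gt
  · exact heq
  · exact absurd (h'.2.2 p hlt hpn) (h.2.1 p (by omega) le_rfl).not_gt

lemma exists_isCut {a : ℕ → ℤ} {m n : ℕ} (hmn : m ≤ n) (h : AscOn a (m + 1) n)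
    (hne : ∀ i ≤ n, a i ≠ a (n + 1)) : ∃ p, m ≤ p ∧ p ≤ n ∧ IsCut a m n p := by
  classical
  let P : ℕ → Prop := fun p => p = m ∨ m < p ∧ a p < a (n + 1)
  have hP : P (Nat.findGreatest P n) := Nat.findGreatest_spec hmn (Or.inl rfl)
  have hm : m ≤ Nat.findGreatest P n := Nat.le_findGreatest hmn (Or.inl rfl)
  have hn : Nat.findGreatest P n ≤ n := Nat.findGreatest_le n
  refine ⟨Nat.findGreatest P n, hm, hn, h, fun i hi hip => ?_, fun i hi hin => ?_⟩
  · rcases hP with hP | ⟨hlt, hP⟩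
    · omega
    · rcases hip.lt_or_eq with hip | hip
      · exact (h i _ hi hip hn).trans hP
      · rwa [hip]
  · have hnot : ¬P i := Nat.findGreatest_is_greatest hi hin
    have := hne i hin
    simp only [P] at hnot
    grind

section DescentWeights

variable {A : Type*} [CommRing A] (s t q : A)

/-- The descent weight of position `i`. -/
def posWeight (i : ℕ) : A := if Even i then s else t

/-- The product of the descent weights of the descents of `a` in positions `0, …, m - 1`. -/
def desWeight (a : ℕ → ℤ) (m : ℕ) : A :=
  ∏ i ∈ range m, if a (i + 1) < a i then posWeight s t i else 1

lemma desWeight_congr {a b : ℕ → ℤ} {m : ℕ}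
    (h : ∀ i < m, (a (i + 1) < a i ↔ b (i + 1) < b i)) : desWeight s t a m = desWeight s t b m :=
  prod_congr rfl fun i hi => by simp only [h i (mem_range.1 hi)]

lemma pow_edesB_mul_pow_odesB {n : ℕ} (w : BG n) :
    s ^ edesB w * t ^ odesB w = desWeight s t (bval w) n := by
  unfold edesB odesB desWeight posWeight
  rw [← prod_const, ← prod_const, prod_filter, prod_filter, ← prod_mul_distrib]
  refine prod_congr rfl fun i _ => ?_
  by_cases h : Even i
  · simp [h]
  · simp [h, Nat.not_even_iff_odd.1 h]

lemma sum_mul_pow_invB_succ {n : ℕ} {f : BG (n + 1) → A} {g : BG n → A}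
    (h : ∀ x, f (appendLetter x) = g x.1) :
    ∑ w, f w * q ^ invB w = (∑ w, g w * q ^ invB w) * qInt (2 * n + 2) q := by
  rw [← (Equiv.ofBijective _ (appendLetter_bijective n)).sum_comp, Fintype.sum_prod_type, sum_mul]
  refine sum_congr rfl fun w _ => ?_
  have hinv (x : BG n × Fin (n + 1) × Bool) : invB (appendLetter x)
      = invB x.1 + if x.2.2 then n + 1 + x.2.1 else n - x.2.1 := wordInv_appendLetter x
  simp only [Equiv.ofBijective_apply, h, hinv, pow_add, mul_assoc, ← mul_sum]
  congr 2
  rw [Fintype.sum_prod_type]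
  simp only [Fintype.sum_bool, if_true, Bool.false_eq_true, if_false]
  rw [sum_add_distrib, Fin.sum_univ_eq_sum_range (fun i => q ^ (n + 1 + i)),
    Fin.sum_univ_eq_sum_range (fun i => q ^ (n - i)), qInt,
    show 2 * n + 2 = (n + 1) + (n + 1) by ring, sum_range_add _ (n + 1) (n + 1), add_comm]
  congr 1
  exact sum_range_reflect (fun i => q ^ i) (n + 1)

lemma BOne_succ (n : ℕ) : BOne (n + 1) q = BOne n q * qInt (2 * n + 2) q := by
  simpa [BOne] using sum_mul_pow_invB_succ q (n := n) (f := fun _ => 1) (g := fun _ => 1)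
    fun _ => rfl

open Classical in
/-- The weighted count of the signed permutations of size `n` that increase on the positions
`l, …, n`, where only the descents in positions `0, …, m - 1` are weighted. -/
def ascSum (n m l : ℕ) : A :=
  ∑ w : BG n, (if AscOn (bval w) l n then desWeight s t (bval w) m else 0) * q ^ invB w

lemma ascSum_of_le {n l : ℕ} (h : n ≤ l) : ascSum s t q n n l = Bpoly n s t q := by
  refine sum_congr rfl fun w _ => ?_
  have hasc : AscOn (bval w) l n := fun i j hi hij hj => by omega
  rw [if_pos hasc, pow_edesB_mul_pow_odesB]

lemma ascOn_iff {a : ℕ → ℤ} {m n : ℕ} (h : m < n) :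
    AscOn a m n ↔ a m < a (m + 1) ∧ AscOn a (m + 1) n := by
  constructor
  · exact fun ha => ⟨ha _ _ le_rfl (by omega) h, fun i j hi => ha i j (by omega)⟩
  · rintro ⟨hlt, ha⟩ i j hi hij hj
    rcases hi.lt_or_eq with hi | rfl
    · exact ha i j hi hij hj
    · rcases Nat.lt_or_ge (m + 1) j with h' | h'
      · exact hlt.trans (ha _ _ le_rfl h' hj)
      · rwa [show j = m + 1 by omega]

lemma ascSum_succ {n m : ℕ} (h : m < n) :
    ascSum s t q n (m + 1) (m + 1) = posWeight s t m * ascSum s t q n m (m + 1)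
      + (1 - posWeight s t m) * ascSum s t q n m m := by
  unfold ascSum
  rw [mul_sum, mul_sum, ← sum_add_distrib]
  refine sum_congr rfl fun w _ => ?_
  have hne : bval w m ≠ bval w (m + 1) := fun heq => by
    have := bval_injOn w h.le h heq
    omega
  rw [ascOn_iff h, desWeight, prod_range_succ, ← desWeight]
  by_cases ha : AscOn (bval w) (m + 1) n
  · rcases hne.lt_or_gt with hlt | hlt
    · simp [ha, hlt, hlt.not_gt]
      ring
    · simp [ha, hlt, hlt.not_gt]
      ring
  · simp [ha]

open Classical in
/-- The part of the count of the words increasing on the positions `m + 1, …, n` in which the last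
letter belongs right after position `p`. -/
def cutSum (n m p : ℕ) : A :=
  ∑ w : BG (n + 1), (if IsCut (bval w) m n p then desWeight s t (bval w) m else 0) * q ^ invB w

lemma cutSum_self (n m : ℕ) : cutSum s t q n m n = ascSum s t q (n + 1) m (m + 1) := by
  classical
  exact sum_congr rfl fun w _ =>
    congrArg (· * q ^ invB w) (if_congr (isCut_self_iff (bval w) m n) rfl rfl)

lemma cutSum_eq_mul {n m p : ℕ} (hmp : m ≤ p) (hpn : p < n) :
    cutSum s t q n m p = q * cutSum s t q n m (p + 1) := by
  unfold cutSum
  rw [← (swapLast (⟨p, by omega⟩ : Fin (n + 1))).sum_comp, mul_sum]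
  refine sum_congr rfl fun w _ => ?_
  have hb : bval (swapLast (⟨p, by omega⟩ : Fin (n + 1)) w)
      = fun i => bval w (Equiv.swap (p + 1) (n + 1) i) := funext fun i => bval_swapLast _ _ _
  rw [hb, isCut_swap _ hmp hpn]
  split_ifs with h
  · have hinv : invB (swapLast (⟨p, by omega⟩ : Fin (n + 1)) w) = invB w + 1 := by
      change wordInv (bval _) (n + 1) = wordInv (bval w) (n + 1) + 1
      rw [hb]
      exact wordInv_swap (by omega) (by omega) (h.2.1 _ (by omega) le_rfl)
        fun i hi hin => h.2.2 i hi (by omega)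
    rw [hinv, pow_succ, desWeight_congr s t (b := bval w)]
    · ring
    · intro i hi
      rw [Equiv.swap_apply_of_ne_of_ne (by omega) (by omega),
        Equiv.swap_apply_of_ne_of_ne (by omega) (by omega)]
  · simp

lemma cutSum_sub {n m k : ℕ} (hk : m + k ≤ n) :
    cutSum s t q n m (n - k) = q ^ k * cutSum s t q n m n := by
  induction k with
  | zero => simp
  | succ k ih =>
    rw [cutSum_eq_mul s t q (by omega) (by omega), show n - (k + 1) + 1 = n - k by omega,
      ih (by omega)]
    ring

open Classical in
lemma sum_cutSum {n m : ℕ} (hmn : m ≤ n) :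
    ∑ k ∈ range (n - m + 1), cutSum s t q n m (n - k)
      = ∑ w : BG (n + 1), (if AscOn (bval w) (m + 1) n then desWeight s t (bval w) m else 0)
        * q ^ invB w := by
  unfold cutSum
  rw [sum_comm]
  refine sum_congr rfl fun w _ => ?_
  rw [← sum_mul]
  congr 1
  split_ifs with h
  · obtain ⟨p, hmp, hpn, hp⟩ := exists_isCut hmn h fun i hi heq => by
      have := bval_injOn w (by omega) le_rfl heq
      omega
    rw [sum_eq_single (n - p), if_pos (by rwa [Nat.sub_sub_self hpn])]
    · intro k hk hkp
      rw [mem_range] at hk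
      refine if_neg fun hcut => hkp ?_
      have := hcut.eq hp (by omega) hmp (by omega) hpn
      omega
    · intro hnot
      rw [mem_range] at hnot
      omega
  · exact sum_eq_zero fun k _ => if_neg fun hcut => h hcut.1

lemma ascSum_size_succ {n m : ℕ} (hmn : m ≤ n) :
    ascSum s t q (n + 1) m (m + 1) * qInt (n - m + 1) q
      = ascSum s t q n m (m + 1) * qInt (2 * n + 2) q := by
  classical
  have h₁ := sum_cutSum s t q hmn
  rw [sum_mul_pow_invB_succ q
    (g := fun w => if AscOn (bval w) (m + 1) n then desWeight s t (bval w) m else 0)] at h₁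
  · have h₂ : ∑ k ∈ range (n - m + 1), cutSum s t q n m (n - k)
        = ascSum s t q (n + 1) m (m + 1) * qInt (n - m + 1) q := by
      rw [← cutSum_self, mul_comm, qInt, sum_mul]
      refine sum_congr rfl fun k hk => cutSum_sub s t q ?_
      rw [mem_range] at hk
      omega
    rw [← h₂, h₁, ascSum]
  · intro x
    have hlt {i j : ℕ} (hi : i ≤ n) (hj : j ≤ n) :
        bval (appendLetter x) i < bval (appendLetter x) j ↔ bval x.1 i < bval x.1 j := by
      rw [bval_appendLetter x hi, bval_appendLetter x hj, (relabel_strictMono _).lt_iff_lt]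
    have hasc : AscOn (bval (appendLetter x)) (m + 1) n ↔ AscOn (bval x.1) (m + 1) n :=
      forall₂_congr fun i j => forall₂_congr fun _ hij => forall_congr' fun hj =>
        hlt (by omega) hj
    rw [hasc, desWeight_congr s t fun i hi => hlt (by omega) (by omega)]

lemma ascSum_mul {n m : ℕ} (hmn : m ≤ n) :
    ascSum s t q n m (m + 1) * (BOne m q * qFact (n - m) q) = Bpoly m s t q * BOne n q := by
  induction n, hmn using Nat.le_induction with
  | base => simp [ascSum_of_le, qFact]
  | succ n hmn ih =>
    rw [show n + 1 - m = n - m + 1 by omega, qFact, prod_range_succ, ← qFact, BOne_succ]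
    linear_combination qInt (2 * n + 2) q * ih
      + BOne m q * qFact (n - m) q * ascSum_size_succ s t q hmn

lemma eq_one_of_ascOn {n : ℕ} {w : BG n} (h : AscOn (bval w) 0 n) :
    w = (1, fun _ => false) := by
  have hs (i : Fin n) : w.2 i = false := by
    have := h 0 (i + 1) le_rfl (by omega) (by omega)
    rw [bval_zero, bval_succ] at this
    by_contra hne
    rw [if_pos (by simpa using hne)] at this
    omega
  have hm : StrictMono w.1 := by
    intro i j hij
    have := h (i + 1) (j + 1) (by omega) (by simpa using hij) (by omega)
    rw [bval_succ, bval_succ, hs, hs] at this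
    simp at this
    exact this
  refine Prod.ext (Equiv.ext fun i => ?_) (funext hs)
  exact congrFun (hm.range_inj strictMono_id |>.1 (by simp [w.1.surjective.range_eq])) i

lemma bval_one {n i : ℕ} (hi : i ≤ n) : bval ((1, fun _ => false) : BG n) i = i := by
  rcases Nat.eq_zero_or_pos i with rfl | h
  · simp [bval_zero]
  · obtain ⟨i, rfl⟩ := exists_fin_of_mem h hi
    rw [bval_succ]
    simp

lemma ascSum_zero (n : ℕ) : ascSum s t q n 0 0 = 1 := by
  unfold ascSum
  rw [sum_eq_single ((1, fun _ => false) : BG n)]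
  · have hasc : AscOn (bval ((1, fun _ => false) : BG n)) 0 n := fun i j _ hij hj => by
      rw [bval_one (by omega), bval_one hj]
      exact_mod_cast hij
    have hinv : invB ((1, fun _ => false) : BG n) = 0 := by
      simp only [invB, Nat.add_eq_zero_iff, card_eq_zero]
      refine ⟨⟨filter_false_of_mem fun x hx => ?_, filter_false_of_mem fun x hx => ?_⟩,
        filter_false_of_mem fun i hi => ?_⟩
      all_goals simp only [mem_product, mem_Icc] at *
      · rw [bval_one hx.1.2, bval_one hx.2.2]
        omega
      · rw [bval_one hx.1.2, bval_one hx.2.2]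
        omega
      · rw [bval_one hi.2]
        omega
    simp [hasc, hinv, desWeight]
  · intro w _ hw
    rw [if_neg fun h => hw (eq_one_of_ascOn h), zero_mul]
  · simp

end DescentWeights

section SolveRecurrence

variable {A : Type*} [CommRing A] {s t : A} {g h : ℕ → A}

lemma even_term_eq_sum {k : ℕ} (hrec : ∀ m < 2 * k,
    h (m + 1) = posWeight s t m * g m + (1 - posWeight s t m) * h m) :
    h (2 * k) = ((1 - t) * (1 - s)) ^ k * h 0 + ∑ r ∈ range k, ((1 - t) * (1 - s)) ^ r
      * (t * g (2 * k - 2 * r - 1) + (1 - t) * s * g (2 * k - 2 * r - 2)) := by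
  induction k with
  | zero => simp
  | succ k ih =>
    have h₁ := hrec (2 * k) (by omega)
    have h₂ := hrec (2 * k + 1) (by omega)
    simp only [posWeight, even_two_mul, if_true] at h₁
    simp only [posWeight, Nat.not_even_two_mul_add_one, if_false] at h₂
    have h₃ : ∀ r, 2 * (k + 1) - 2 * (r + 1) = 2 * k - 2 * r := fun r => by omega
    have h₄ : 2 * (k + 1) - 2 * 0 - 1 = 2 * k + 1 := by omega
    have h₅ : 2 * (k + 1) - 2 * 0 - 2 = 2 * k := by omega
    rw [sum_range_succ', h₄, h₅]
    simp only [h₃, pow_succ', mul_assoc ((1 - t) * (1 - s)), ← mul_sum]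
    rw [show 2 * (k + 1) = 2 * k + 1 + 1 by ring, h₂, h₁]
    linear_combination (1 - t) * (1 - s) * ih fun m hm => hrec m (by omega)

lemma even_term_recurrence {k : ℕ} (hrec : ∀ m < 2 * k,
    h (m + 1) = posWeight s t m * g m + (1 - posWeight s t m) * h m) (hg : g (2 * k) = h (2 * k)) :
    h (2 * k) = (1 - t) ^ k * (1 - s) ^ (k + 1) * h 0
      + ∑ r ∈ range k, t * (1 - t) ^ r * (1 - s) ^ (r + 1) * g (2 * k - 2 * r - 1)
      + ∑ r ∈ range (k + 1), s * (1 - t) ^ r * (1 - s) ^ r * g (2 * k - 2 * r) := by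
  have key := even_term_eq_sum hrec
  rw [mul_pow] at key
  rw [sum_range_succ', Nat.mul_zero, Nat.sub_zero, hg]
  have hsum : (1 - s) * ∑ r ∈ range k, ((1 - t) * (1 - s)) ^ r
        * (t * g (2 * k - 2 * r - 1) + (1 - t) * s * g (2 * k - 2 * r - 2))
      = ∑ r ∈ range k, t * (1 - t) ^ r * (1 - s) ^ (r + 1) * g (2 * k - 2 * r - 1)
        + ∑ r ∈ range k, s * (1 - t) ^ (r + 1) * (1 - s) ^ (r + 1) * g (2 * k - 2 * (r + 1)) := by
    rw [mul_sum, ← sum_add_distrib]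
    refine sum_congr rfl fun r _ => ?_
    rw [show 2 * k - 2 * (r + 1) = 2 * k - 2 * r - 2 by omega, mul_pow]
    ring
  linear_combination (1 - s) * key + hsum

lemma odd_term_recurrence {k : ℕ} (hrec : ∀ m < 2 * k + 1,
    h (m + 1) = posWeight s t m * g m + (1 - posWeight s t m) * h m)
    (hg : g (2 * k + 1) = h (2 * k + 1)) :
    h (2 * k + 1) = (1 - t) ^ (k + 1) * (1 - s) ^ (k + 1) * h 0
      + ∑ r ∈ range (k + 1), s * (1 - t) ^ (r + 1) * (1 - s) ^ r * g (2 * k + 1 - (2 * r + 1))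
      + ∑ r ∈ range (k + 1), t * (1 - t) ^ r * (1 - s) ^ r * g (2 * k + 1 - 2 * r) := by
  have key := even_term_eq_sum fun m (hm : m < 2 * k) => hrec m (by omega)
  rw [mul_pow] at key
  have hlast := hrec (2 * k) (by omega)
  simp only [posWeight, even_two_mul, if_true] at hlast
  rw [sum_range_succ', sum_range_succ' (fun r => t * (1 - t) ^ r * (1 - s) ^ r * _),
    Nat.mul_zero, Nat.zero_add, Nat.sub_zero, Nat.add_sub_cancel, hg]
  have hsum : (1 - t) * (1 - s) * ∑ r ∈ range k, ((1 - t) * (1 - s)) ^ r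
        * (t * g (2 * k - 2 * r - 1) + (1 - t) * s * g (2 * k - 2 * r - 2))
      = ∑ r ∈ range k, s * (1 - t) ^ (r + 1 + 1) * (1 - s) ^ (r + 1)
          * g (2 * k + 1 - (2 * (r + 1) + 1))
        + ∑ r ∈ range k, t * (1 - t) ^ (r + 1) * (1 - s) ^ (r + 1)
          * g (2 * k + 1 - 2 * (r + 1)) := by
    rw [mul_sum, ← sum_add_distrib]
    refine sum_congr rfl fun r _ => ?_
    rw [show 2 * k + 1 - (2 * (r + 1) + 1) = 2 * k - 2 * r - 2 by omega,
      show 2 * k + 1 - 2 * (r + 1) = 2 * k - 2 * r - 1 by omega, mul_pow]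
    ring
  linear_combination (1 - t) * hlast + (1 - t) * (1 - s) * key + hsum

end SolveRecurrence

section Field

variable {F : Type*} [Field F] {q : F}

lemma qFact_ne_zero (hq : ∀ k, qInt (k + 1) q ≠ 0) (n : ℕ) : qFact n q ≠ 0 :=
  prod_ne_zero_iff.2 fun i _ => hq i

lemma BOne_ne_zero (hq : ∀ k, qInt (k + 1) q ≠ 0) (n : ℕ) : BOne n q ≠ 0 := by
  induction n with
  | zero => simp [BOne, invB]
  | succ n ih =>
    rw [BOne_succ]
    exact mul_ne_zero ih (hq _)

lemma ascSum_div_succ (hq : ∀ k, qInt (k + 1) q ≠ 0) (s t : F) {n m : ℕ} (h : m < n) :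
    ascSum s t q n (m + 1) (m + 1) / BOne n q
      = posWeight s t m * (Bpoly m s t q / (BOne m q * qFact (n - m) q))
        + (1 - posWeight s t m) * (ascSum s t q n m m / BOne n q) := by
  have hn := BOne_ne_zero hq n
  have hm := mul_ne_zero (BOne_ne_zero hq m) (qFact_ne_zero hq (n - m))
  have key : ascSum s t q n m (m + 1) / BOne n q
      = Bpoly m s t q / (BOne m q * qFact (n - m) q) := by
    rw [div_eq_div_iff hn hm, ascSum_mul s t q h.le]
  rw [ascSum_succ s t q h, ← key]
  ring

end Field

lemma qInt_succ_qK_ne_zero (k : ℕ) : qInt (k + 1) qK ≠ 0 := by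
  have hmap : qInt (k + 1) qK = algebraMap (MvPolynomial (Fin 3) ℚ) K
      (∑ i ∈ range (k + 1), MvPolynomial.X 0 ^ i) := by
    simp [qInt, qK]
  rw [hmap, Ne, FaithfulSMul.algebraMap_eq_zero_iff]
  intro h
  have := congrArg (MvPolynomial.eval fun _ => (1 : ℚ)) h
  simp at this
  norm_cast at this

theorem typeB_q_recurrence :
    -- even case `n = 2k`, `k ≥ 1`
    (∀ k : ℕ, 1 ≤ k →
      Bpoly (2 * k) sK tK qK / BOne (2 * k) qK =
        (1 - tK) ^ k * (1 - sK) ^ (k + 1) / BOne (2 * k) qK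
        + (∑ r ∈ range k, tK * (1 - tK) ^ r * (1 - sK) ^ (r + 1)
            * Bpoly (2 * k - 2 * r - 1) sK tK qK
              / (BOne (2 * k - 2 * r - 1) qK * qFact (2 * r + 1) qK))
        + ∑ r ∈ range (k + 1), sK * (1 - tK) ^ r * (1 - sK) ^ r
            * Bpoly (2 * k - 2 * r) sK tK qK
              / (BOne (2 * k - 2 * r) qK * qFact (2 * r) qK))
    ∧
    -- odd case `n = 2k+1`
    (∀ k : ℕ,
      Bpoly (2 * k + 1) sK tK qK / BOne (2 * k + 1) qK =
        (1 - tK) ^ (k + 1) * (1 - sK) ^ (k + 1) / BOne (2 * k + 1) qK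
        + (∑ r ∈ range (k + 1), sK * (1 - tK) ^ (r + 1) * (1 - sK) ^ r
            * Bpoly (2 * k + 1 - (2 * r + 1)) sK tK qK
              / (BOne (2 * k + 1 - (2 * r + 1)) qK * qFact (2 * r + 1) qK))
        + ∑ r ∈ range (k + 1), tK * (1 - tK) ^ r * (1 - sK) ^ r
            * Bpoly (2 * k + 1 - 2 * r) sK tK qK
              / (BOne (2 * k + 1 - 2 * r) qK * qFact (2 * r) qK)) := by
  constructor
  · intro k _
    have key := even_term_recurrence (k := k)
      (h := fun m => ascSum sK tK qK (2 * k) m m / BOne (2 * k) qK)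
      (g := fun m => Bpoly m sK tK qK / (BOne m qK * qFact (2 * k - m) qK))
      (fun m hm => ascSum_div_succ qInt_succ_qK_ne_zero sK tK hm)
      (by simp [ascSum_of_le, qFact])
    simp only [ascSum_of_le _ _ _ le_rfl, ascSum_zero] at key
    rw [key, mul_one_div]
    congr 1
    · congr 1
      refine sum_congr rfl fun r hr => ?_
      rw [mem_range] at hr
      rw [show 2 * k - (2 * k - 2 * r - 1) = 2 * r + 1 by omega, mul_div_assoc]
    · refine sum_congr rfl fun r hr => ?_
      rw [mem_range] at hr
      rw [show 2 * k - (2 * k - 2 * r) = 2 * r by omega, mul_div_assoc]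
  · intro k
    have key := odd_term_recurrence (k := k)
      (h := fun m => ascSum sK tK qK (2 * k + 1) m m / BOne (2 * k + 1) qK)
      (g := fun m => Bpoly m sK tK qK / (BOne m qK * qFact (2 * k + 1 - m) qK))
      (fun m hm => ascSum_div_succ qInt_succ_qK_ne_zero sK tK hm)
      (by simp [ascSum_of_le, qFact])
    simp only [ascSum_of_le _ _ _ le_rfl, ascSum_zero] at key
    rw [key, mul_one_div]
    congr 1
    · congr 1
      refine sum_congr rfl fun r hr => ?_
      rw [mem_range] at hr
      rw [show 2 * k + 1 - (2 * k + 1 - (2 * r + 1)) = 2 * r + 1 by omega, mul_div_assoc]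
    · refine sum_congr rfl fun r hr => ?_
      rw [mem_range] at hr
      rw [show 2 * k + 1 - (2 * k + 1 - 2 * r) = 2 * r by omega, mul_div_assoc]

end
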